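/- arXiv:2111.08123 — 10 statements merged into one kernel-verified Lean document; each statement's English description precedes it below -/
import Mathlib

section
/- For every family z assigning to each pair (e, f) of finite subsets of V an element of M, and for every pair (e, f) of finite subsets of V, one has (δ(δ⁺z))_{e,f} = −(δ⁺(δz))_{e,f}; that is, the difference operators satisfy δ ∘ δ⁺ = −δ⁺ ∘ δ. -/
/-- `sigmaPos e i` is the number of elements of `e` strictly smaller than `i`,
i.e. the position of `i` in the increasing enumeration of `e`. -/
def sigmaPos {V : Type*} [LinearOrder V] (e : Finset V) (i : V) : ℕ :=
  (e.filter (fun j => j < i)).card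

/-- The difference operator `(δz)_{e,f} = Σ_{i ∈ e} (−1)^{σ_e(i)} • z_{e∖{i}, f∖{i}}`. -/
def deltaOp {V : Type*} [LinearOrder V] {M : Type*} [AddCommGroup M]
    (z : Finset V → Finset V → M) : Finset V → Finset V → M :=
  fun e f => ∑ i ∈ e, ((-1 : ℤ) ^ sigmaPos e i) • z (e.erase i) (f.erase i)

/-- The difference operator `(δ⁺z)_{e,f} = Σ_{i ∈ e} (−1)^{σ_e(i)} • z_{e∖{i}, f}`. -/
def deltaPlusOp {V : Type*} [LinearOrder V] {M : Type*} [AddCommGroup M]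
    (z : Finset V → Finset V → M) : Finset V → Finset V → M :=
  fun e f => ∑ i ∈ e, ((-1 : ℤ) ^ sigmaPos e i) • z (e.erase i) f

theorem sigmaPos_erase_of_lt {V : Type*} [LinearOrder V] (e : Finset V) (i j : V)
    (hi : i ∈ e) (h : i < j) : sigmaPos e j = sigmaPos (e.erase i) j + 1 := by
  unfold sigmaPos
  rw [Finset.filter_erase, Finset.card_erase_add_one]
  simp [hi, h]

theorem sigmaPos_erase_of_gt {V : Type*} [LinearOrder V] (e : Finset V) (i j : V)
    (h : i < j) : sigmaPos (e.erase j) i = sigmaPos e i := by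
  unfold sigmaPos
  rw [Finset.filter_erase, Finset.erase_eq_of_notMem]
  simp [h.le]

theorem sign_swap {V : Type*} [LinearOrder V] (e : Finset V) (i j : V)
    (hi : i ∈ e) (hj : j ∈ e) (h : i ≠ j) :
    (-1 : ℤ) ^ sigmaPos e i * (-1) ^ sigmaPos (e.erase i) j =
      -((-1) ^ sigmaPos e j * (-1) ^ sigmaPos (e.erase j) i) := by
  rcases lt_or_gt_of_ne h with h | h
  · rw [sigmaPos_erase_of_lt e i j hi h, sigmaPos_erase_of_gt e i j h]
    ring
  · rw [sigmaPos_erase_of_lt e j i hj h, sigmaPos_erase_of_gt e j i h]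
    ring

theorem deltaOp_deltaPlusOp_anticomm {V : Type*} [LinearOrder V] {M : Type*} [AddCommGroup M]
    (z : Finset V → Finset V → M) (e f : Finset V) :
    deltaOp (deltaPlusOp z) e f = -(deltaPlusOp (deltaOp z) e f) := by
  simp only [deltaOp, deltaPlusOp, Finset.smul_sum, ← Finset.sum_neg_distrib, smul_smul]
  rw [Finset.sum_comm' (t' := e) (s' := fun j => e.erase j)]
  · refine Finset.sum_congr rfl fun j hj => Finset.sum_congr rfl fun i hi => ?_
    rw [Finset.mem_erase] at hi
    rw [sign_swap e i j hi.2 hj hi.1, neg_smul, Finset.erase_right_comm]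
  · intro i j
    simp only [Finset.mem_erase]
    tauto
end

section
/- For every finite subset e of V and every pair of distinct elements i, p ∈ e, one has σ_{e∖{p}}(i) + σ_{e∖{i}}(p) = σ_e(i) + σ_e(p) − 1. In particular, the signs satisfy (−1)^{σ_e(p) + σ_{e∖{p}}(i)} = −(−1)^{σ_e(i) + σ_{e∖{i}}(p)}. -/
theorem sigmaPos_erase_aux {V : Type*} [LinearOrder V] (e : Finset V) (i p : V)
    (hp : p ∈ e) : sigmaPos (e.erase p) i + (if p < i then 1 else 0) = sigmaPos e i := by
  unfold sigmaPos
  rw [Finset.filter_erase]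
  split_ifs with h
  · exact Finset.card_erase_add_one (Finset.mem_filter.mpr ⟨hp, h⟩)
  · rw [Finset.erase_eq_of_notMem (by simp [h])]
    rfl

theorem sigmaPos_erase_identity {V : Type*} [LinearOrder V] (e : Finset V) (i p : V)
    (hi : i ∈ e) (hp : p ∈ e) (hip : i ≠ p) :
    sigmaPos (e.erase p) i + sigmaPos (e.erase i) p + 1 = sigmaPos e i + sigmaPos e p ∧
    (-1 : ℤ) ^ (sigmaPos e p + sigmaPos (e.erase p) i) =
      -(-1 : ℤ) ^ (sigmaPos e i + sigmaPos (e.erase i) p) := by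
  have h1 := sigmaPos_erase_aux e i p hp
  have h2 := sigmaPos_erase_aux e p i hi
  have key : sigmaPos (e.erase p) i + sigmaPos (e.erase i) p + 1
      = sigmaPos e i + sigmaPos e p := by
    rcases lt_or_gt_of_ne hip with h | h
    · rw [if_neg h.not_gt] at h1
      rw [if_pos h] at h2
      omega
    · rw [if_pos h] at h1
      rw [if_neg h.not_gt] at h2
      omega
  refine ⟨key, ?_⟩
  rcases Nat.even_or_odd (sigmaPos e i + sigmaPos (e.erase i) p) with h | h
  · have h' : Odd (sigmaPos e p + sigmaPos (e.erase p) i) := by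
      rw [Nat.odd_iff]; rw [Nat.even_iff] at h; omega
    rw [h.neg_one_pow, h'.neg_one_pow]
  · have h' : Even (sigmaPos e p + sigmaPos (e.erase p) i) := by
      rw [Nat.even_iff]; rw [Nat.odd_iff] at h; omega
    rw [h.neg_one_pow, h'.neg_one_pow, neg_neg]
end

section
/- Let n ≥ 1, let c > 0, and let T_1, …, T_N be n-simplices in ℝⁿ with pairwise disjoint interiors, each c-shape-regular, and all containing a common point x₀. Then N ≤ (2c)ⁿ. -/
open Metric Set

/-- An `n`-simplex in `ℝⁿ` (given by its `n+1` affinely independent vertices `v`) is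
`c`-shape-regular if it contains a closed ball `B` with `diam(T) ≤ c ⬝ diam(B)`. -/
def SimplexShapeRegular {n : ℕ} (c : ℝ) (v : Fin (n + 1) → EuclideanSpace ℝ (Fin n)) : Prop :=
  ∃ (x : EuclideanSpace ℝ (Fin n)) (r : ℝ),
    Metric.closedBall x r ⊆ convexHull ℝ (Set.range v) ∧
    Metric.diam (convexHull ℝ (Set.range v)) ≤ c * Metric.diam (Metric.closedBall x r)

open MeasureTheory in
theorem packing_bound (n N : ℕ) (h ρ : ℝ) (hh : 0 < h) (hρ : 0 < ρ)
    (x₀ : EuclideanSpace ℝ (Fin n)) (y : Fin N → EuclideanSpace ℝ (Fin n))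
    (hd : Pairwise (fun i j => Disjoint (ball (y i) ρ) (ball (y j) ρ)))
    (hs : ∀ i, ball (y i) ρ ⊆ closedBall x₀ h) : (N : ℝ) * ρ ^ n ≤ h ^ n := by
  let μ : Measure (EuclideanSpace ℝ (Fin n)) := volume
  have h1 : μ (⋃ i, ball (y i) ρ) ≤ μ (closedBall x₀ h) := measure_mono (iUnion_subset hs)
  rw [measure_iUnion hd (fun i => measurableSet_ball), tsum_fintype] at h1
  simp only [μ.addHaar_ball_of_pos _ hρ, μ.addHaar_closedBall _ hh.le, finrank_euclideanSpace,
    Fintype.card_fin, Finset.sum_const, Finset.card_univ, nsmul_eq_mul] at h1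
  rw [← mul_assoc, ENNReal.mul_le_mul_iff_left (measure_ball_pos μ _ one_pos).ne'
    measure_ball_lt_top.ne, ← ENNReal.ofReal_natCast, ← ENNReal.ofReal_mul (by positivity),
    ENNReal.ofReal_le_ofReal_iff (by positivity)] at h1
  exact h1

theorem shrink_ball (n : ℕ) (c h : ℝ) (hc : 0 < c) (hh : 0 < h)
    (T : Set (EuclideanSpace ℝ (Fin n))) (hT : Convex ℝ T) (hb : Bornology.IsBounded T)
    (hd : h ≤ diam T) (x₀ x : EuclideanSpace ℝ (Fin n)) (hx₀ : x₀ ∈ T) (r : ℝ)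
    (hB : closedBall x r ⊆ T) (hr : diam T ≤ c * diam (closedBall x r)) :
    ∃ y, ball y (h / (2 * c)) ⊆ T ∧ ball y (h / (2 * c)) ⊆ closedBall x₀ h := by
  have hD : 0 < diam T := hh.trans_le hd
  have hr0 : 0 ≤ r := by
    by_contra hneg
    push Not at hneg
    rw [closedBall_eq_empty.2 hneg, diam_empty] at hr
    linarith
  have hr2 : diam T ≤ c * (2 * r) :=
    hr.trans (mul_le_mul_of_nonneg_left (diam_closedBall hr0) hc.le)
  set D := diam T with hDdef
  have key : ∀ z ∈ ball (x₀ + (h / D) • (x - x₀)) (h / (2 * c)),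
      ∃ w ∈ T, z = x₀ + (h / D) • (w - x₀) := by
    intro z hz
    refine ⟨x₀ + (D / h) • (z - x₀), hB ?_, ?_⟩
    · have e : x₀ + (D / h) • (z - x₀) - x = (D / h) • (z - (x₀ + (h / D) • (x - x₀))) := by
        have : (D / h) * (h / D) = 1 := by field_simp
        rw [← sub_sub z, smul_sub _ (z - x₀), smul_smul, this, one_smul]
        abel
      rw [mem_ball, dist_eq_norm] at hz
      rw [mem_closedBall, dist_eq_norm, e, norm_smul, Real.norm_of_nonneg (by positivity)]
      calc D / h * _ ≤ D / h * (h / (2 * c)) := by gcongr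
        _ = D / (2 * c) := by field_simp
        _ ≤ r := by rw [div_le_iff₀ (by positivity)]; linarith
    · have : (h / D) * (D / h) = 1 := by field_simp
      rw [add_sub_cancel_left, smul_smul, this, one_smul]
      abel
  refine ⟨x₀ + (h / D) • (x - x₀), ?_, ?_⟩
  · intro z hz
    obtain ⟨w, hw, rfl⟩ := key z hz
    exact hT.add_smul_sub_mem hx₀ hw ⟨by positivity, (div_le_one hD).2 hd⟩
  · intro z hz
    obtain ⟨w, hw, rfl⟩ := key z hz
    rw [mem_closedBall, dist_eq_norm, add_sub_cancel_left, norm_smul,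
      Real.norm_of_nonneg (by positivity), ← dist_eq_norm]
    calc h / D * dist w x₀ ≤ h / D * D := by
          gcongr
          exact dist_le_diam_of_mem hb hw hx₀
      _ = h := by field_simp

/-- If `T_1, …, T_N` are `n`-simplices in `ℝⁿ` with pairwise disjoint interiors, each
`c`-shape-regular, all containing a common point `x₀`, then `N ≤ (2c)ⁿ`. -/
theorem card_le_of_shapeRegular_common_vertex
    (n : ℕ) (hn : 1 ≤ n) (c : ℝ) (hc : 0 < c) (N : ℕ)
    (v : Fin N → Fin (n + 1) → EuclideanSpace ℝ (Fin n))
    (hindep : ∀ i, AffineIndependent ℝ (v i))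
    (hdisj : ∀ i j, i ≠ j →
      Disjoint (interior (convexHull ℝ (Set.range (v i))))
        (interior (convexHull ℝ (Set.range (v j)))))
    (hreg : ∀ i, SimplexShapeRegular c (v i))
    (x₀ : EuclideanSpace ℝ (Fin n))
    (hx₀ : ∀ i, x₀ ∈ convexHull ℝ (Set.range (v i))) :
    (N : ℝ) ≤ (2 * c) ^ n := by
  rcases Nat.eq_zero_or_pos N with rfl | hN
  · simp only [Nat.cast_zero]; positivity
  have hbd : ∀ i, Bornology.IsBounded (convexHull ℝ (Set.range (v i))) := fun i =>
    isBounded_convexHull.2 (Set.finite_range _).isBounded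
  have hpos : ∀ i, 0 < diam (convexHull ℝ (Set.range (v i))) := by
    intro i
    have hne : v i 0 ≠ v i (Fin.last n) := by
      intro h
      have := congrArg Fin.val ((hindep i).injective h)
      simp at this
      omega
    exact (dist_pos.2 hne).trans_le (dist_le_diam_of_mem (hbd i)
      (subset_convexHull ℝ _ ⟨_, rfl⟩) (subset_convexHull ℝ _ ⟨_, rfl⟩))
  haveI : Nonempty (Fin N) := ⟨⟨0, hN⟩⟩
  obtain ⟨i₀, hi₀⟩ := Finite.exists_min (fun i => diam (convexHull ℝ (Set.range (v i))))
  set h := diam (convexHull ℝ (Set.range (v i₀))) with hdef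
  have hh : 0 < h := hpos i₀
  have H : ∀ i, ∃ y, ball y (h / (2 * c)) ⊆ convexHull ℝ (Set.range (v i)) ∧
      ball y (h / (2 * c)) ⊆ closedBall x₀ h := by
    intro i
    obtain ⟨x, r, hB, hr⟩ := hreg i
    exact shrink_ball n c h hc hh _ (convex_convexHull ℝ _) (hbd i) (hi₀ i) x₀ x (hx₀ i) r hB hr
  choose y hy1 hy2 using H
  have := packing_bound n N h (h / (2 * c)) hh (by positivity) x₀ y (fun i j hij =>
    (hdisj i j hij).mono (interior_maximal (hy1 i) isOpen_ball)
      (interior_maximal (hy1 j) isOpen_ball)) hy2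
  rw [div_pow, ← mul_div_assoc, div_le_iff₀ (by positivity), mul_comm (h ^ n)] at this
  exact le_of_mul_le_mul_right this (by positivity)
end

section
/- Suppose 𝒯 is c-shape-regular for some c > 0. Then for every n-simplex T of 𝒯, the number of n-simplices f of 𝒯 such that convexHull(T) ⊆ Ω_f^E is at most (n+1)·(2c)ⁿ. -/
open Metric Set Geometry

/-- The macroelement `Ω_f`: the union of the convex hulls of the `n`-simplices
(faces with `n+1` elements) of the complex `K` that contain `f`. -/
def macroelement (n : ℕ) (K : Geometry.SimplicialComplex ℝ (EuclideanSpace ℝ (Fin n)))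
    (f : Finset (EuclideanSpace ℝ (Fin n))) : Set (EuclideanSpace ℝ (Fin n)) :=
  ⋃ T ∈ {T : Finset (EuclideanSpace ℝ (Fin n)) | T ∈ K.faces ∧ T.card = n + 1 ∧ f ⊆ T},
    convexHull ℝ (T : Set (EuclideanSpace ℝ (Fin n)))

/-- The extended macroelement `Ω_f^E`: the union of the macroelements `Ω_{{x}}`
over the vertices `x ∈ f`. -/
def extMacroelement (n : ℕ) (K : Geometry.SimplicialComplex ℝ (EuclideanSpace ℝ (Fin n)))
    (f : Finset (EuclideanSpace ℝ (Fin n))) : Set (EuclideanSpace ℝ (Fin n)) :=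
  ⋃ x ∈ f, macroelement n K {x}

/-- The complex `K` is `c`-shape-regular: every `n`-simplex `T` of `K` contains a closed
ball `B ⊆ convexHull(T)` with `diam(convexHull T) ≤ c ⬝ diam(B)`. -/
def ComplexShapeRegular (n : ℕ) (c : ℝ)
    (K : Geometry.SimplicialComplex ℝ (EuclideanSpace ℝ (Fin n))) : Prop :=
  ∀ T ∈ K.faces, T.card = n + 1 →
    ∃ (x : EuclideanSpace ℝ (Fin n)) (r : ℝ),
      Metric.closedBall x r ⊆ convexHull ℝ (T : Set (EuclideanSpace ℝ (Fin n))) ∧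
      Metric.diam (convexHull ℝ (T : Set (EuclideanSpace ℝ (Fin n)))) ≤
        c * Metric.diam (Metric.closedBall x r)

open MeasureTheory in
/-- Distinct `n`-simplices overlap in a null set. -/
lemma volume_inter_eq_zero (n : ℕ) (K : Geometry.SimplicialComplex ℝ (EuclideanSpace ℝ (Fin n)))
    (f g : Finset (EuclideanSpace ℝ (Fin n))) (hf : f ∈ K.faces) (hg : g ∈ K.faces)
    (hfc : f.card = n + 1) (hgc : g.card = n + 1) (hne : f ≠ g) :
    volume (convexHull ℝ (f : Set (EuclideanSpace ℝ (Fin n))) ∩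
      convexHull ℝ (g : Set (EuclideanSpace ℝ (Fin n)))) = 0 := by
  classical
  refine measure_mono_null (K.inter_subset_convexHull hf hg) ?_
  rw [← Finset.coe_inter]
  rcases (f ∩ g).eq_empty_or_nonempty with he | hno
  · simp [he]
  refine measure_mono_null (convexHull_subset_affineSpan _) ?_
  refine Measure.addHaar_affineSubspace _ _ ?_
  intro htop
  have : Nonempty (f ∩ g : Finset _) := hno.to_subtype
  have h1 := finrank_vectorSpan_range_add_one_le ℝ
    (fun y : (f ∩ g : Finset (EuclideanSpace ℝ (Fin n))) => (y : EuclideanSpace ℝ (Fin n)))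
  have h2 : Set.range (fun y : (f ∩ g : Finset (EuclideanSpace ℝ (Fin n))) =>
      (y : EuclideanSpace ℝ (Fin n))) = ((f ∩ g : Finset _) : Set (EuclideanSpace ℝ (Fin n))) := by
    ext; simp
  rw [h2, ← direction_affineSpan, htop, AffineSubspace.direction_top, finrank_top,
    finrank_euclideanSpace_fin, Fintype.card_coe] at h1
  have h3 : f ∩ g = f := Finset.eq_of_subset_of_card_le Finset.inter_subset_left (by omega)
  have h4 : f ∩ g = g := Finset.eq_of_subset_of_card_le Finset.inter_subset_right (by omega)
  exact hne (h3.symm.trans h4)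

lemma exists_normalized_ball (n : ℕ) (hn : 1 ≤ n)
    (K : Geometry.SimplicialComplex ℝ (EuclideanSpace ℝ (Fin n)))
    (c : ℝ) (hc : 0 < c) (hreg : ComplexShapeRegular n c K)
    (x : EuclideanSpace ℝ (Fin n))
    (f : Finset (EuclideanSpace ℝ (Fin n))) (hf : f ∈ K.faces)
    (hfc : f.card = n + 1) (hx : x ∈ f) :
    ∃ (z : EuclideanSpace ℝ (Fin n)) (h : ℝ), 0 < h ∧
      Metric.ball z (1 / (2 * c)) ⊆ Metric.closedBall x 1 ∧
      ∀ p ∈ Metric.ball z (1 / (2 * c)),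
        x + h • (p - x) ∈ interior (convexHull ℝ (f : Set (EuclideanSpace ℝ (Fin n)))) := by
  obtain ⟨z, r, hball, hdiam⟩ := hreg f hf hfc
  have hbd : Bornology.IsBounded (convexHull ℝ (f : Set (EuclideanSpace ℝ (Fin n)))) :=
    isBounded_convexHull.2 f.finite_toSet.isBounded
  set h := Metric.diam (convexHull ℝ (f : Set (EuclideanSpace ℝ (Fin n)))) with hh
  have hxc : x ∈ convexHull ℝ (f : Set (EuclideanSpace ℝ (Fin n))) :=
    subset_convexHull ℝ _ hx
  have hpos : 0 < h := by
    obtain ⟨y, hy, hyx⟩ := Finset.exists_mem_ne (by omega : 1 < f.card) x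
    have hyc : y ∈ convexHull ℝ (f : Set (EuclideanSpace ℝ (Fin n))) := subset_convexHull ℝ _ hy
    exact (dist_pos.2 hyx).trans_le (Metric.dist_le_diam_of_mem hbd hyc hxc)
  have hr : 0 ≤ r := by
    by_contra hr
    rw [Metric.closedBall_eq_empty.2 (not_le.1 hr), Metric.diam_empty] at hdiam
    linarith
  have hhr : h ≤ c * (2 * r) :=
    hdiam.trans (mul_le_mul_of_nonneg_left (Metric.diam_closedBall hr) hc.le)
  have key : ∀ p ∈ Metric.ball (x + h⁻¹ • (z - x)) (1 / (2 * c)),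
      x + h • (p - x) ∈ Metric.ball z r := by
    intro p hp
    rw [mem_ball_iff_norm] at hp ⊢
    have e : x + h • (p - x) - z = h • (p - (x + h⁻¹ • (z - x))) := by
      simp only [smul_sub, smul_add, smul_smul, mul_inv_cancel₀ hpos.ne', one_smul]
      abel
    rw [e, norm_smul, Real.norm_of_nonneg hpos.le]
    calc _ < h * (1 / (2 * c)) := mul_lt_mul_of_pos_left hp hpos
      _ ≤ r := by
        rw [mul_one_div, div_le_iff₀ (by positivity)]
        linarith
  refine ⟨x + h⁻¹ • (z - x), h, hpos, ?_, ?_⟩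
  · intro p hp
    have h1 := Metric.dist_le_diam_of_mem hbd (hball (Metric.ball_subset_closedBall (key p hp))) hxc
    rw [dist_eq_norm, add_sub_cancel_left, norm_smul, Real.norm_of_nonneg hpos.le, ← hh] at h1
    rw [mem_closedBall_iff_norm]
    nlinarith
  · intro p hp
    exact interior_maximal (Metric.ball_subset_closedBall.trans hball) Metric.isOpen_ball (key p hp)

open MeasureTheory in
/-- At most `(2c)^n` simplices share a vertex. -/
lemma card_star_le (n : ℕ) (hn : 1 ≤ n)
    (K : Geometry.SimplicialComplex ℝ (EuclideanSpace ℝ (Fin n)))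
    (c : ℝ) (hc : 0 < c) (hreg : ComplexShapeRegular n c K)
    (x : EuclideanSpace ℝ (Fin n)) (S : Finset (Finset (EuclideanSpace ℝ (Fin n))))
    (hS : ∀ f ∈ S, f ∈ K.faces ∧ f.card = n + 1 ∧ x ∈ f) :
    (S.card : ℝ) ≤ (2 * c) ^ n := by
  classical
  have H : ∀ f : Finset (EuclideanSpace ℝ (Fin n)), ∃ (z : EuclideanSpace ℝ (Fin n)) (h : ℝ),
      f ∈ S → 0 < h ∧
      Metric.ball z (1 / (2 * c)) ⊆ Metric.closedBall x 1 ∧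
      ∀ p ∈ Metric.ball z (1 / (2 * c)),
        x + h • (p - x) ∈ interior (convexHull ℝ (f : Set (EuclideanSpace ℝ (Fin n)))) := by
    intro f
    by_cases hfS : f ∈ S
    · obtain ⟨h1, h2, h3⟩ := hS f hfS
      obtain ⟨z, h, hz⟩ := exists_normalized_ball n hn K c hc hreg x f h1 h2 h3
      exact ⟨z, h, fun _ => hz⟩
    · exact ⟨0, 0, fun h => absurd h hfS⟩
  choose z h H using H
  have D : Set.PairwiseDisjoint (S : Set (Finset (EuclideanSpace ℝ (Fin n))))
      (fun f => Metric.ball (z f) (1 / (2 * c))) := by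
    intro f hf g hg hne
    refine Set.disjoint_left.2 fun p hpf hpg => ?_
    obtain ⟨hf1, hf2, hf3⟩ := hS f hf
    obtain ⟨hg1, hg2, hg3⟩ := hS g hg
    obtain ⟨hfp, -, hfi⟩ := H f hf
    obtain ⟨hgp, -, hgi⟩ := H g hg
    have aux : ∀ (g : Finset (EuclideanSpace ℝ (Fin n))) (a t : ℝ), x ∈ g → 0 < a → 0 < t → t ≤ a →
        x + a • (p - x) ∈ interior (convexHull ℝ (g : Set (EuclideanSpace ℝ (Fin n)))) →
        x + t • (p - x) ∈ interior (convexHull ℝ (g : Set (EuclideanSpace ℝ (Fin n)))) := by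
      intro g a t hxg ha ht hta hin
      have := (convex_convexHull ℝ (g : Set (EuclideanSpace ℝ (Fin n)))).add_smul_mem_interior
        (subset_convexHull ℝ _ hxg) hin (t := t / a) ⟨by positivity, (div_le_one ha).2 hta⟩
      rwa [smul_smul, div_mul_cancel₀ _ ha.ne'] at this
    have ht : 0 < min (h f) (h g) := lt_min hfp hgp
    have q1 := aux f _ _ hf3 hfp ht (min_le_left _ _) (hfi p hpf)
    have q2 := aux g _ _ hg3 hgp ht (min_le_right _ _) (hgi p hpg)
    have hz := measure_mono_null (Set.inter_subset_inter interior_subset interior_subset)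
      (volume_inter_eq_zero n K f g hf1 hg1 hf2 hg2 hne)
    exact (IsOpen.measure_pos volume (isOpen_interior.inter isOpen_interior) ⟨_, q1, q2⟩).ne' hz
  have hδ : 0 < 1 / (2 * c) := by positivity
  have I : (S.card : ENNReal) * ENNReal.ofReal ((1 / (2 * c)) ^ n) *
      volume (Metric.ball (0 : EuclideanSpace ℝ (Fin n)) 1) ≤
      ENNReal.ofReal (1 ^ n) * volume (Metric.ball (0 : EuclideanSpace ℝ (Fin n)) 1) :=
    calc _ = volume (⋃ f ∈ S, Metric.ball (z f) (1 / (2 * c))) := by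
          rw [measure_biUnion_finset D fun c _ => measurableSet_ball]
          simp only [Measure.addHaar_ball_of_pos volume _ hδ, finrank_euclideanSpace_fin]
          simp only [Finset.sum_const, nsmul_eq_mul, mul_assoc]
      _ ≤ volume (Metric.closedBall x 1) :=
          measure_mono (Set.iUnion₂_subset fun f hf => (H f hf).2.1)
      _ = _ := by
          rw [Measure.addHaar_closedBall volume _ zero_le_one, finrank_euclideanSpace_fin]
  have J := (ENNReal.mul_le_mul_iff_left (measure_ball_pos _ _ zero_lt_one).ne'
    measure_ball_lt_top.ne).1 I
  have L := ENNReal.toReal_le_of_le_ofReal (by positivity) J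
  rw [ENNReal.toReal_mul, ENNReal.toReal_natCast, ENNReal.toReal_ofReal (by positivity),
    one_pow, div_pow, one_pow, mul_one_div, div_le_one (by positivity)] at L
  exact L

open MeasureTheory in
/-- If `T` is inside the extended macroelement of `f`, they share a vertex. -/
lemma exists_common_vertex (n : ℕ) (hn : 1 ≤ n)
    (K : Geometry.SimplicialComplex ℝ (EuclideanSpace ℝ (Fin n)))
    (hfin : K.faces.Finite)
    (c : ℝ) (hc : 0 < c) (hreg : ComplexShapeRegular n c K)
    (T : Finset (EuclideanSpace ℝ (Fin n))) (hT : T ∈ K.faces) (hTcard : T.card = n + 1)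
    (f : Finset (EuclideanSpace ℝ (Fin n)))
    (hTf : convexHull ℝ (T : Set (EuclideanSpace ℝ (Fin n))) ⊆ extMacroelement n K f) :
    ∃ x ∈ T, x ∈ f := by
  by_contra! hcon
  obtain ⟨x, hx⟩ : T.Nonempty := Finset.card_pos.1 (by omega)
  obtain ⟨z, h, -, -, hz⟩ := exists_normalized_ball n hn K c hc hreg x T hT hTcard hx
  have hpos : 0 < volume (convexHull ℝ (T : Set (EuclideanSpace ℝ (Fin n)))) :=
    Measure.measure_pos_of_nonempty_interior _
      ⟨_, hz z (Metric.mem_ball_self (by positivity))⟩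
  refine hpos.ne' (measure_mono_null (t := ⋃ g ∈ {g ∈ K.faces | g.card = n + 1 ∧ T ≠ g},
    (convexHull ℝ (T : Set (EuclideanSpace ℝ (Fin n))) ∩
      convexHull ℝ (g : Set (EuclideanSpace ℝ (Fin n))))) ?_ ?_)
  · intro p hp
    have := hTf hp
    simp only [extMacroelement, macroelement, Set.mem_iUnion] at this
    obtain ⟨y, hy, g, ⟨hg1, hg2, hg3⟩, hpg⟩ := this
    refine Set.mem_iUnion₂.2 ⟨g, ⟨hg1, hg2, ?_⟩, hp, hpg⟩
    rintro rfl
    exact hcon y (hg3 (Finset.mem_singleton_self y)) hy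
  · rw [measure_biUnion_null_iff (hfin.subset fun g hg => hg.1).countable]
    intro g hg
    exact volume_inter_eq_zero n K T g hT hg.1 hTcard hg.2.1 hg.2.2

/-- If the finite complex `𝒯` (all of whose maximal faces have `n+1` elements) is
`c`-shape-regular, then for every `n`-simplex `T` of `𝒯` the number of `n`-simplices
`f` with `convexHull(T) ⊆ Ω_f^E` is at most `(n+1)·(2c)ⁿ`. -/
theorem card_extMacroelement_overlap_le
    (n : ℕ) (hn : 1 ≤ n) (K : Geometry.SimplicialComplex ℝ (EuclideanSpace ℝ (Fin n)))
    (hfin : K.faces.Finite)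
    (hmax : ∀ f ∈ K.faces, (∀ g ∈ K.faces, f ⊆ g → f = g) → f.card = n + 1)
    (c : ℝ) (hc : 0 < c) (hreg : ComplexShapeRegular n c K)
    (T : Finset (EuclideanSpace ℝ (Fin n))) (hT : T ∈ K.faces) (hTcard : T.card = n + 1) :
    ({f : Finset (EuclideanSpace ℝ (Fin n)) | f ∈ K.faces ∧ f.card = n + 1 ∧
        convexHull ℝ (T : Set (EuclideanSpace ℝ (Fin n))) ⊆ extMacroelement n K f}.ncard : ℝ) ≤
      (n + 1) * (2 * c) ^ n := by
  classical
  set A := hfin.toFinset.filter (fun f => f.card = n + 1) with hA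
  have hsub : {f : Finset (EuclideanSpace ℝ (Fin n)) | f ∈ K.faces ∧ f.card = n + 1 ∧
        convexHull ℝ (T : Set (EuclideanSpace ℝ (Fin n))) ⊆ extMacroelement n K f} ⊆
      ((T.biUnion fun x => A.filter (fun f => x ∈ f) : Finset _) :
        Set (Finset (EuclideanSpace ℝ (Fin n)))) := by
    rintro f ⟨h1, h2, h3⟩
    obtain ⟨x, hxT, hxf⟩ := exists_common_vertex n hn K hfin c hc hreg T hT hTcard f h3
    simp only [Finset.coe_biUnion, Set.mem_iUnion]
    exact ⟨x, hxT, by simp [hA, h1, h2, hxf]⟩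
  have h1 := (Set.ncard_le_ncard hsub (Finset.finite_toSet _)).trans_eq (Set.ncard_coe_finset _)
  have h2 := h1.trans Finset.card_biUnion_le
  calc _ ≤ ((∑ x ∈ T, (A.filter (fun f => x ∈ f)).card : ℕ) : ℝ) := by exact_mod_cast h2
    _ = ∑ x ∈ T, ((A.filter (fun f => x ∈ f)).card : ℝ) := by push_cast; rfl
    _ ≤ ∑ x ∈ T, (2 * c) ^ n := Finset.sum_le_sum fun x _ =>
        card_star_le n hn K c hc hreg x _ (by
          intro f hf
          simpa [hA, and_assoc] using hf)
    _ = _ := by simp [hTcard]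
end

section
/- For any two n-simplices T and f of 𝒯, one has convexHull(T) ⊆ Ω_f^E if and only if T and f have a common vertex, i.e., T ∩ f ≠ ∅. -/
open Metric Set Geometry

/-- The barycenter of an affinely independent set is not in the hull of a proper subset. -/
theorem barycenter_notMem_hull {E : Type*} [AddCommGroup E] [Module ℝ E] [DecidableEq E]
    (T : Finset E) (hT : AffineIndependent ℝ ((↑) : T → E)) (y : E) (hy : y ∈ T)
    (h : (∑ i ∈ T, (T.card : ℝ)⁻¹ • i) ∈ convexHull ℝ ((T.erase y : Finset E) : Set E)) :
    False := by
  have hc : (T.card : ℝ) ≠ 0 := by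
    exact_mod_cast (Finset.card_pos.2 ⟨y, hy⟩).ne'
  rw [Finset.mem_convexHull'] at h
  obtain ⟨w, -, hw1, hw2⟩ := h
  rw [affineIndependent_iff] at hT
  let v : E → ℝ := fun i => (T.card : ℝ)⁻¹ - if i = y then 0 else w i
  have e1 : ∑ i ∈ T, (if i = y then 0 else w i) = 1 := by
    rw [← Finset.add_sum_erase _ _ hy, ← hw1, if_pos rfl, zero_add]
    exact Finset.sum_congr rfl fun i hi => if_neg (Finset.ne_of_mem_erase hi)
  have e2 : ∑ i ∈ T, (if i = y then 0 else w i) • i = ∑ i ∈ T, (T.card : ℝ)⁻¹ • i := by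
    rw [← Finset.add_sum_erase _ _ hy, ← hw2, if_pos rfl, zero_smul, zero_add]
    exact Finset.sum_congr rfl fun i hi => by rw [if_neg (Finset.ne_of_mem_erase hi)]
  have key := hT Finset.univ (fun i => v i) ?_ ?_ ⟨y, hy⟩ (Finset.mem_univ _)
  · simp [v] at key
    exact hc (by simp [key])
  · rw [Finset.sum_coe_sort T v]
    simp only [v, Finset.sum_sub_distrib, e1, Finset.sum_const, nsmul_eq_mul]
    rw [mul_inv_cancel₀ hc, sub_self]
  · rw [Finset.sum_coe_sort T (fun i => v i • i)]
    simp only [v, sub_smul, Finset.sum_sub_distrib, e2, sub_self]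

/-- For two `n`-simplices `T` and `f` of a finite simplicial complex in `ℝⁿ` all of whose
maximal faces have `n+1` elements, `convexHull(T) ⊆ Ω_f^E` if and only if `T` and `f`
have a common vertex, i.e. `T ∩ f ≠ ∅`. -/
theorem convexHull_subset_extMacroelement_iff
    (n : ℕ) (hn : 1 ≤ n) (K : Geometry.SimplicialComplex ℝ (EuclideanSpace ℝ (Fin n)))
    (hfin : K.faces.Finite)
    (hmax : ∀ f ∈ K.faces, (∀ g ∈ K.faces, f ⊆ g → f = g) → f.card = n + 1)
    (T f : Finset (EuclideanSpace ℝ (Fin n)))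
    (hT : T ∈ K.faces) (hTcard : T.card = n + 1)
    (hf : f ∈ K.faces) (hfcard : f.card = n + 1) :
    convexHull ℝ (T : Set (EuclideanSpace ℝ (Fin n))) ⊆ extMacroelement n K f ↔
      ∃ x, x ∈ T ∧ x ∈ f := by
  classical
  constructor
  · intro h
    have hc : (T.card : ℝ) ≠ 0 := by rw [hTcard]; positivity
    have hb : (∑ i ∈ T, (T.card : ℝ)⁻¹ • i) ∈
        convexHull ℝ (T : Set (EuclideanSpace ℝ (Fin n))) := by
      rw [Finset.mem_convexHull']
      refine ⟨fun _ => (T.card : ℝ)⁻¹, fun _ _ => by positivity, ?_, rfl⟩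
      rw [Finset.sum_const, nsmul_eq_mul, mul_inv_cancel₀ hc]
    have h2 := h hb
    simp only [extMacroelement, macroelement, mem_iUnion, mem_ofPred_eq] at h2
    obtain ⟨x, hx, T', ⟨hT', hcard, hxT'⟩, hb'⟩ := h2
    refine ⟨x, ?_, hx⟩
    have hsub : T ⊆ T' := by
      intro y hy
      by_contra hyT'
      refine barycenter_notMem_hull T (K.indep hT) y hy
        (convexHull_mono ?_ (K.inter_subset_convexHull hT hT' ⟨hb, hb'⟩))
      rintro z ⟨hz, hz'⟩
      exact Finset.mem_coe.2 (Finset.mem_erase.2 ⟨fun e => hyT' (e ▸ hz'), hz⟩)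
    rw [Finset.eq_of_subset_of_card_le hsub (by rw [hcard, hTcard])]
    exact hxT' (Finset.mem_singleton_self x)
  · rintro ⟨x, hxT, hxf⟩ p hp
    simp only [extMacroelement, macroelement, mem_iUnion, mem_ofPred_eq]
    exact ⟨x, hxf, T, ⟨hT, hTcard, Finset.singleton_subset_iff.2 hxT⟩, hp⟩
end

section
/- For every n-simplex T of 𝒯 and every m with 0 ≤ m ≤ n, the number of m-faces f of 𝒯 such that convexHull(T) ⊆ Ω_f is at most the binomial coefficient C(n+1, m+1). Consequently, the overlap of the family of macroelements {Ω_f : f an m-face of 𝒯} is bounded by a constant depending only on m and n. -/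
open Metric Set Geometry

/-- If a point with nonzero barycentric coordinates in an affinely independent `T` lies in the
convex hull of a subset `S` of `T`, then `S = T`; here the centroid is used. -/
lemma subset_of_centroid_mem {E : Type*} [AddCommGroup E] [Module ℝ E] {T S : Finset E}
    (hT : AffineIndependent ℝ ((↑) : T → E)) (hne : T.Nonempty) (hS : S ⊆ T)
    (h : (∑ y ∈ T, ((T.card : ℝ)⁻¹) • y) ∈ convexHull ℝ (S : Set E)) : T ⊆ S := by
  classical
  rw [Finset.mem_convexHull'] at h
  obtain ⟨w, -, hw1, hw⟩ := h
  intro v hv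
  by_contra hvS
  have hcard : (T.card : ℝ) ≠ 0 := by
    exact_mod_cast hne.card_pos.ne'
  let u : E → ℝ := fun y => (if y ∈ S then w y else 0) - (T.card : ℝ)⁻¹
  have e : ∀ {M : Type _} [AddCommMonoid M] (g : E → M), ∑ y ∈ T, (if y ∈ S then g y else 0)
      = ∑ y ∈ S, g y := by
    intro M _ g
    rw [← Finset.sum_filter, Finset.filter_mem_eq_inter, Finset.inter_eq_right.2 hS]
  have h0 : ∑ y ∈ T, u y = 0 := by
    simp only [u, Finset.sum_sub_distrib]
    rw [← Finset.sum_filter, Finset.filter_mem_eq_inter, Finset.inter_eq_right.2 hS, hw1]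
    simp [hcard]
  have h1 : ∑ y ∈ T, u y • y = 0 := by
    simp only [u, sub_smul, Finset.sum_sub_distrib, ite_smul, zero_smul]
    rw [e, hw, sub_self]
  have := (affineIndependent_iff.1 hT) Finset.univ (fun y => u y)
    (by rw [← h0]; exact Finset.sum_coe_sort T u)
    (by rw [← h1]; exact Finset.sum_coe_sort T (fun y => u y • y)) ⟨v, hv⟩ (Finset.mem_univ _)
  simp [u, hvS, hne.ne_empty] at this

/-- For every `n`-simplex `T` of the finite complex `𝒯` (all of whose maximal faces have
`n+1` elements) and every `m ≤ n`, the number of `m`-faces `f` with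
`convexHull(T) ⊆ Ω_f` is at most the binomial coefficient `C(n+1, m+1)`; hence the overlap
of the family `{Ω_f : f an m-face}` is bounded by a constant depending only on `m` and `n`. -/
theorem card_macroelement_overlap_le_choose
    (n : ℕ) (hn : 1 ≤ n) (K : Geometry.SimplicialComplex ℝ (EuclideanSpace ℝ (Fin n)))
    (hfin : K.faces.Finite)
    (hmax : ∀ f ∈ K.faces, (∀ g ∈ K.faces, f ⊆ g → f = g) → f.card = n + 1)
    (T : Finset (EuclideanSpace ℝ (Fin n))) (hT : T ∈ K.faces) (hTcard : T.card = n + 1)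
    (m : ℕ) (hm : m ≤ n) :
    {f : Finset (EuclideanSpace ℝ (Fin n)) | f ∈ K.faces ∧ f.card = m + 1 ∧
        convexHull ℝ (T : Set (EuclideanSpace ℝ (Fin n))) ⊆ macroelement n K f}.ncard ≤
      Nat.choose (n + 1) (m + 1) := by
  classical
  have hsub : {f : Finset (EuclideanSpace ℝ (Fin n)) | f ∈ K.faces ∧ f.card = m + 1 ∧
        convexHull ℝ (T : Set (EuclideanSpace ℝ (Fin n))) ⊆ macroelement n K f} ⊆
      (T.powersetCard (m + 1) : Set (Finset (EuclideanSpace ℝ (Fin n)))) := by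
    rintro f ⟨-, hfc, hf⟩
    have hne : T.Nonempty := Finset.card_pos.1 (by omega)
    have hcard : (T.card : ℝ) ≠ 0 := by
      exact_mod_cast hne.card_pos.ne'
    have hc : (∑ y ∈ T, ((T.card : ℝ)⁻¹) • y) ∈
        convexHull ℝ (T : Set (EuclideanSpace ℝ (Fin n))) := by
      rw [Finset.mem_convexHull']
      exact ⟨fun _ => (T.card : ℝ)⁻¹, fun _ _ => by positivity, by simp [hcard], rfl⟩
    have h2 := hf hc
    simp only [macroelement, mem_iUnion, mem_setOf_eq] at h2
    obtain ⟨T', ⟨hT', hT'c, hfT'⟩, hcT'⟩ := h2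
    have h3 := K.inter_subset_convexHull hT hT' ⟨hc, hcT'⟩
    rw [← Finset.coe_inter] at h3
    have h4 := subset_of_centroid_mem (K.indep hT) hne Finset.inter_subset_left h3
    have h5 : T = T' := Finset.eq_of_subset_of_card_le
      (h4.trans Finset.inter_subset_right) (by omega)
    rw [Finset.mem_coe, Finset.mem_powersetCard]
    exact ⟨h5 ▸ hfT', hfc⟩
  calc _ ≤ _ := Set.ncard_le_ncard hsub (Finset.finite_toSet _)
    _ = _ := by rw [Set.ncard_coe_finset, Finset.card_powersetCard, hTcard]
end

section
/- Let T be an n-simplex in ℝⁿ containing a closed ball of radius ρ > 0, and let c > 0 satisfy diam(T) ≤ 2cρ. Then for every m with 1 ≤ m ≤ n and every m-face f of T, one has diam(T)^m ≤ β_m^{-1}·(2c)^m·μ^m(f), where μ^m denotes m-dimensional Hausdorff measure on ℝⁿ; equivalently, μ^m(f) ≥ β_m·ρ^m. -/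
open Metric Set MeasureTheory

/-- With the normalisation of Mathlib, Lebesgue measure is at most Hausdorff measure. -/
lemma volume_le_hausdorff_aux (m : ℕ) (A : Set (EuclideanSpace ℝ (Fin m))) :
    volume A ≤ μH[(m : ℝ)] A := by
  have h1 : LipschitzWith 1 (fun x : EuclideanSpace ℝ (Fin m) => WithLp.ofLp x) :=
    PiLp.lipschitzWith_ofLp 2 _
  have h2 := h1.hausdorffMeasure_image_le (d := (m : ℝ)) (by positivity) A
  have h3 : (μH[(m : ℝ)] : Measure (Fin m → ℝ)) = volume := by
    have := hausdorffMeasure_pi_real (ι := Fin m)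
    simpa using this
  rw [h3] at h2
  simp only [ENNReal.coe_one, ENNReal.one_rpow, one_mul] at h2
  refine le_trans (le_of_eq ?_) h2
  have h6 := (EuclideanSpace.volume_preserving_symm_measurableEquiv_toLp (Fin m)).measure_preimage_equiv
    (WithLp.ofLp '' A)
  rw [← h6]
  congr 1
  ext x
  constructor
  · intro hx
    exact ⟨x, hx, rfl⟩
  · rintro ⟨y, hy, hxy⟩
    have : y = x := (WithLp.ofLp_injective 2) hxy
    exact this ▸ hy

/-- Translates of the ball section of the simplex lie in the face. -/
lemma face_contains_aux
    (n m : ℕ) (v : Fin (n + 1) → EuclideanSpace ℝ (Fin n)) (hindep : AffineIndependent ℝ v)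
    (ρ : ℝ) (hρ : 0 < ρ) (x₀ : EuclideanSpace ℝ (Fin n))
    (hball : Metric.closedBall x₀ ρ ⊆ convexHull ℝ (Set.range v))
    (s : Finset (Fin (n + 1))) (hs : s.card = m + 1) :
    ∃ p : EuclideanSpace ℝ (Fin n), ∀ w ∈ vectorSpan ℝ (v '' (s : Set (Fin (n + 1)))),
      ‖w‖ ≤ ρ → w + p ∈ convexHull ℝ (v '' (s : Set (Fin (n + 1)))) := by
  have htop : affineSpan ℝ (Set.range v) = ⊤ := by
    rw [hindep.affineSpan_eq_top_iff_card_eq_finrank_add_one]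
    simp
  let b : AffineBasis (Fin (n + 1)) ℝ (EuclideanSpace ℝ (Fin n)) := ⟨v, hindep, htop⟩
  have hbv : ∀ i, b i = v i := fun i => rfl
  have hcoord : ∀ x ∈ convexHull ℝ (Set.range v), ∀ i, 0 ≤ b.coord i x := by
    intro x hx
    have : x ∈ convexHull ℝ (Set.range b) := hx
    rw [b.convexHull_eq_nonneg_coord] at this
    exact this
  obtain ⟨i₀, hi₀⟩ : s.Nonempty := Finset.card_pos.1 (by omega)
  have hker : ∀ i ∉ s, ∀ w ∈ vectorSpan ℝ (v '' (s : Set (Fin (n + 1)))),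
      (b.coord i).linear w = 0 := by
    intro i hi w hw
    have hle : vectorSpan ℝ (v '' (s : Set (Fin (n + 1)))) ≤ LinearMap.ker (b.coord i).linear := by
      rw [vectorSpan_def, Submodule.span_le]
      rintro _ ⟨_, ⟨j, hj, rfl⟩, _, ⟨k, hk, rfl⟩, rfl⟩
      have hij : i ≠ j := fun h => hi (h ▸ hj)
      have hik : i ≠ k := fun h => hi (h ▸ hk)
      simp only [SetLike.mem_coe, LinearMap.mem_ker, AffineMap.linearMap_vsub]
      rw [← hbv j, ← hbv k, b.coord_apply_ne hij, b.coord_apply_ne hik]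
      simp
    exact hle hw
  set t : ℝ := ∑ i ∈ s, b.coord i x₀ with ht
  have hx₀ : x₀ ∈ convexHull ℝ (Set.range v) := hball (by simp [hρ.le])
  have hsum1 : ∀ x, ∑ i ∈ s, b.coord i x + ∑ i ∈ sᶜ, b.coord i x = 1 := by
    intro x
    rw [Finset.sum_add_sum_compl, b.sum_coord_apply_eq_one]
  have ht1 : t ≤ 1 := by
    have h := hsum1 x₀
    have : 0 ≤ ∑ i ∈ sᶜ, b.coord i x₀ := Finset.sum_nonneg fun i _ => hcoord x₀ hx₀ i
    linarith
  refine ⟨x₀ - ∑ i ∈ sᶜ, b.coord i x₀ • v i + (1 - t) • v i₀, fun w hw hwρ => ?_⟩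
  have hx : w + x₀ ∈ convexHull ℝ (Set.range v) := hball (by simpa using hwρ)
  have hcompl : ∀ i ∈ sᶜ, b.coord i (w + x₀) = b.coord i x₀ := by
    intro i hi
    have h := (b.coord i).map_vadd x₀ w
    rw [hker i (by simpa using hi) w hw] at h
    simpa using h
  have hsum : ∑ i ∈ s, b.coord i (w + x₀) = t := by
    have h1 := hsum1 (w + x₀)
    have h2 := hsum1 x₀
    rw [Finset.sum_congr rfl hcompl] at h1
    linarith
  have hrep : ∑ i ∈ s, b.coord i (w + x₀) • v i + ∑ i ∈ sᶜ, b.coord i x₀ • v i = w + x₀ := by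
    have h := b.linear_combination_coord_eq_self (w + x₀)
    rw [← Finset.sum_add_sum_compl s] at h
    have h' : ∑ i ∈ sᶜ, b.coord i (w + x₀) • b i = ∑ i ∈ sᶜ, b.coord i x₀ • v i :=
      Finset.sum_congr rfl (fun i hi => by rw [hcompl i hi, hbv])
    rw [h'] at h
    exact h
  have heq : w + (x₀ - ∑ i ∈ sᶜ, b.coord i x₀ • v i + (1 - t) • v i₀)
      = ∑ i ∈ s, (b.coord i (w + x₀) + if i = i₀ then 1 - t else 0) • v i := by
    simp only [add_smul, Finset.sum_add_distrib, ite_smul, zero_smul, Finset.sum_ite_eq', hi₀,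
      if_true]
    rw [eq_sub_of_add_eq hrep]
    abel
  rw [heq]
  refine (convex_convexHull ℝ _).sum_mem (fun i _ => ?_) ?_ (fun i hi => ?_)
  · have := hcoord _ hx i
    split_ifs <;> linarith
  · rw [Finset.sum_add_distrib, hsum]
    simp [hi₀]
  · exact subset_convexHull ℝ _ ⟨i, hi, rfl⟩

/-- Let `T = convexHull(range v)` be an `n`-simplex in `ℝⁿ` containing a closed ball of radius
`ρ > 0`, and let `c > 0` satisfy `diam(T) ≤ 2cρ`.  Then for every `m` with `1 ≤ m ≤ n` and
every `m`-face `f` of `T` (the convex hull of the vertices indexed by a subset `s` of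
cardinality `m+1`), one has `diam(T)^m ≤ β_m⁻¹ ⬝ (2c)^m ⬝ μ^m(f)`, where `μ^m` is the
`m`-dimensional Hausdorff measure and `β_m` is the volume of the unit ball in `ℝ^m`;
equivalently `μ^m(f) ≥ β_m ⬝ ρ^m`. -/
theorem face_volume_lower_bound
    (n m : ℕ) (hm : 1 ≤ m) (hmn : m ≤ n)
    (v : Fin (n + 1) → EuclideanSpace ℝ (Fin n)) (hindep : AffineIndependent ℝ v)
    (ρ c : ℝ) (hρ : 0 < ρ) (hc : 0 < c)
    (x₀ : EuclideanSpace ℝ (Fin n))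
    (hball : Metric.closedBall x₀ ρ ⊆ convexHull ℝ (Set.range v))
    (hdiam : Metric.diam (convexHull ℝ (Set.range v)) ≤ 2 * c * ρ)
    (s : Finset (Fin (n + 1))) (hs : s.card = m + 1) :
    ENNReal.ofReal (Metric.diam (convexHull ℝ (Set.range v)) ^ m) ≤
        (volume (Metric.ball (0 : EuclideanSpace ℝ (Fin m)) 1))⁻¹ *
          ENNReal.ofReal ((2 * c) ^ m) * μH[(m : ℝ)] (convexHull ℝ (v '' ↑s)) ∧
      volume (Metric.ball (0 : EuclideanSpace ℝ (Fin m)) 1) * ENNReal.ofReal (ρ ^ m) ≤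
        μH[(m : ℝ)] (convexHull ℝ (v '' ↑s)) := by
  have key : volume (Metric.ball (0 : EuclideanSpace ℝ (Fin m)) 1) * ENNReal.ofReal (ρ ^ m) ≤
      μH[(m : ℝ)] (convexHull ℝ (v '' ↑s)) := by
    obtain ⟨p, hp⟩ := face_contains_aux n m v hindep ρ hρ x₀ hball s hs
    set W := vectorSpan ℝ (v '' (s : Set (Fin (n + 1)))) with hW
    have hfr : Module.finrank ℝ W = m := by
      have h := hindep.finrank_vectorSpan_image_finset (s := s) hs
      rw [Finset.coe_image] at h
      exact h
    let e : EuclideanSpace ℝ (Fin m) ≃ₗᵢ[ℝ] W :=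
      ((stdOrthonormalBasis ℝ W).reindex (finCongr hfr)).repr.symm
    let g : EuclideanSpace ℝ (Fin m) → EuclideanSpace ℝ (Fin n) := fun z => (e z : _) + p
    have hg : Isometry g := by
      refine Isometry.of_dist_eq fun x y => ?_
      simp only [g, dist_add_right]
      rw [← Subtype.dist_eq, e.dist_map]
    have hsub : g '' (Metric.ball 0 ρ) ⊆ convexHull ℝ (v '' ↑s) := by
      rintro _ ⟨z, hz, rfl⟩
      refine hp _ (e z).2 ?_
      rw [← Submodule.coe_norm, e.norm_map]
      exact (mem_ball_zero_iff.1 hz).le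
    calc volume (Metric.ball (0 : EuclideanSpace ℝ (Fin m)) 1) * ENNReal.ofReal (ρ ^ m)
        = volume (Metric.ball (0 : EuclideanSpace ℝ (Fin m)) ρ) := by
          rw [Measure.addHaar_ball_of_pos _ _ hρ, mul_comm]
          simp
      _ ≤ μH[(m : ℝ)] (Metric.ball (0 : EuclideanSpace ℝ (Fin m)) ρ) := volume_le_hausdorff_aux m _
      _ = μH[(m : ℝ)] (g '' (Metric.ball 0 ρ)) :=
          (hg.hausdorffMeasure_image (Or.inl (by positivity)) _).symm
      _ ≤ _ := measure_mono hsub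
  refine ⟨?_, key⟩
  have hβ0 : volume (Metric.ball (0 : EuclideanSpace ℝ (Fin m)) 1) ≠ 0 :=
    (measure_ball_pos _ _ one_pos).ne'
  have hβt : volume (Metric.ball (0 : EuclideanSpace ℝ (Fin m)) 1) ≠ ⊤ := measure_ball_lt_top.ne
  calc ENNReal.ofReal (Metric.diam (convexHull ℝ (Set.range v)) ^ m)
      ≤ ENNReal.ofReal ((2 * c) ^ m * ρ ^ m) := by
        apply ENNReal.ofReal_le_ofReal
        rw [← mul_pow]
        exact pow_le_pow_left₀ Metric.diam_nonneg hdiam m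
    _ = (volume (Metric.ball (0 : EuclideanSpace ℝ (Fin m)) 1))⁻¹ * ENNReal.ofReal ((2 * c) ^ m) *
        (volume (Metric.ball (0 : EuclideanSpace ℝ (Fin m)) 1) * ENNReal.ofReal (ρ ^ m)) := by
        rw [ENNReal.ofReal_mul (by positivity), mul_mul_mul_comm, ENNReal.inv_mul_cancel hβ0 hβt,
          one_mul]
    _ ≤ _ := by gcongr
end

section
/- Let c > 0 and let T_0, T_1, …, T_s be n-simplices in ℝⁿ, each c-shape-regular, such that for every j with 0 ≤ j < s the simplices T_j and T_{j+1} have at least two vertices in common. Then diam(T_0) ≤ c^s · diam(T_s). In particular, any two n-simplices of a c-shape-regular triangulation that can be joined by a chain of length s of n-simplices in which consecutive simplices share an edge have diameters comparable up to the factor c^s. -/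
open Metric Set

/-- A ball inside a simplex has diameter at most the length of any edge. -/
theorem ball_diam_le_edge {n : ℕ} (v : Fin (n + 1) → EuclideanSpace ℝ (Fin n))
    (hv : AffineIndependent ℝ v) (p : EuclideanSpace ℝ (Fin n)) (r : ℝ)
    (hsub : Metric.closedBall p r ⊆ convexHull ℝ (Set.range v))
    (i k : Fin (n + 1)) (hik : v i ≠ v k) :
    Metric.diam (Metric.closedBall p r) ≤ dist (v i) (v k) := by
  rcases lt_or_ge r 0 with hr | hr
  · rw [Metric.closedBall_eq_empty.2 hr, Metric.diam_empty]
    exact dist_nonneg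
  refine (Metric.diam_closedBall hr).trans ?_
  have htop : affineSpan ℝ (Set.range v) = ⊤ := by
    rw [hv.affineSpan_eq_top_iff_card_eq_finrank_add_one]
    simp
  let b : AffineBasis (Fin (n + 1)) ℝ (EuclideanSpace ℝ (Fin n)) := ⟨v, hv, htop⟩
  have hb : ∀ z ∈ convexHull ℝ (Set.range v), 0 ≤ b.coord i z ∧ b.coord i z ≤ 1 := by
    intro z hz
    have h0 : ∀ j, 0 ≤ b.coord j z := by
      have h := b.convexHull_eq_nonneg_coord
      have hz' : z ∈ convexHull ℝ (Set.range b) := hz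
      rw [h] at hz'
      exact hz'
    refine ⟨h0 i, ?_⟩
    rw [← b.sum_coord_apply_eq_one z]
    exact Finset.single_le_sum (f := fun j => b.coord j z) (fun j _ => h0 j) (Finset.mem_univ i)
  have hne : k ≠ i := fun h => hik (by rw [h])
  have h1 : b.coord i (v i) = 1 := b.coord_apply_eq i
  have h2 : b.coord i (v k) = 0 := b.coord_apply_ne hne.symm
  have hd : 0 < dist (v i) (v k) := dist_pos.2 hik
  set d := dist (v i) (v k) with hdd
  have hn : ‖v i - v k‖ = d := by rw [hdd, dist_eq_norm]
  have hlin : (b.coord i).linear (v i - v k) = 1 := by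
    have := (b.coord i).linearMap_vsub (v i) (v k)
    simp only [vsub_eq_sub] at this
    rw [this, h1, h2, sub_zero]
  have hval : ∀ t : ℝ, b.coord i (p + t • (v i - v k)) = t + b.coord i p := by
    intro t
    have := (b.coord i).map_vadd p (t • (v i - v k))
    simp only [vadd_eq_add, map_smul, hlin, smul_eq_mul, mul_one] at this
    rw [add_comm p, this]
  have hmem : ∀ t : ℝ, |t| = r / d → p + t • (v i - v k) ∈ convexHull ℝ (Set.range v) := by
    intro t ht
    apply hsub
    rw [Metric.mem_closedBall, dist_eq_norm, add_sub_cancel_left, norm_smul, hn,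
      Real.norm_eq_abs, ht, div_mul_cancel₀ _ hd.ne']
  have hrd : 0 ≤ r / d := by positivity
  have ha := (hb _ (hmem (r / d) (abs_of_nonneg hrd))).2
  have hc := (hb _ (hmem (-(r / d)) (by rw [abs_neg, abs_of_nonneg hrd]))).1
  rw [hval] at ha hc
  have : 2 * r / d ≤ 1 := by rw [mul_div_assoc]; linarith
  rwa [div_le_one hd] at this

/-- If `T_0, T_1, …, T_s` are `c`-shape-regular `n`-simplices in `ℝⁿ` such that consecutive
simplices `T_j` and `T_{j+1}` share at least two vertices (an edge), then
`diam(T_0) ≤ c^s ⬝ diam(T_s)`. -/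
theorem diam_le_of_edge_chain
    (n s : ℕ) (c : ℝ) (hc : 0 < c)
    (v : Fin (s + 1) → Fin (n + 1) → EuclideanSpace ℝ (Fin n))
    (hindep : ∀ j, AffineIndependent ℝ (v j))
    (hreg : ∀ j, SimplexShapeRegular c (v j))
    (hshare : ∀ j : Fin s, ∃ x y : EuclideanSpace ℝ (Fin n), x ≠ y ∧
      x ∈ Set.range (v j.castSucc) ∧ x ∈ Set.range (v j.succ) ∧
      y ∈ Set.range (v j.castSucc) ∧ y ∈ Set.range (v j.succ)) :
    Metric.diam (convexHull ℝ (Set.range (v 0))) ≤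
      c ^ s * Metric.diam (convexHull ℝ (Set.range (v (Fin.last s)))) := by
  have step : ∀ j : Fin s, Metric.diam (convexHull ℝ (Set.range (v j.castSucc))) ≤
      c * Metric.diam (convexHull ℝ (Set.range (v j.succ))) := by
    intro j
    obtain ⟨x, y, hxy, ⟨i, rfl⟩, hx, ⟨k, rfl⟩, hy⟩ := hshare j
    obtain ⟨p, r, hsub, hle⟩ := hreg j.castSucc
    refine hle.trans (mul_le_mul_of_nonneg_left ?_ hc.le)
    refine (ball_diam_le_edge _ (hindep _) p r hsub i k hxy).trans ?_
    refine Metric.dist_le_diam_of_mem ?_ (subset_convexHull ℝ _ hx) (subset_convexHull ℝ _ hy)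
    exact isBounded_convexHull.2 (Set.finite_range _).isBounded
  have key : ∀ j : Fin (s + 1), Metric.diam (convexHull ℝ (Set.range (v 0))) ≤
      c ^ (j : ℕ) * Metric.diam (convexHull ℝ (Set.range (v j))) := by
    intro j
    induction j using Fin.induction with
    | zero => simp
    | succ j ih =>
      refine ih.trans ?_
      rw [Fin.val_succ, pow_succ, mul_assoc]
      exact mul_le_mul_of_nonneg_left (step j) (by positivity)
  simpa using key (Fin.last s)
end

section
/- Let g be a face of 𝒯 that is contained in at least one n-simplex of 𝒯. Then the macroelement Ω_g is star-convex with respect to every point of the convex hull of g; in particular, Ω_g (with the subspace topology from ℝⁿ) is a contractible space. -/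
open Metric Set Geometry

/-- If `g` is a face of the finite complex `𝒯` (all of whose maximal faces have `n+1`
elements) contained in at least one `n`-simplex, then the macroelement `Ω_g` is
star-convex with respect to every point of `convexHull(g)`; in particular `Ω_g` is a
contractible space. -/
theorem macroelement_starConvex_and_contractible
    (n : ℕ) (hn : 1 ≤ n) (K : Geometry.SimplicialComplex ℝ (EuclideanSpace ℝ (Fin n)))
    (hfin : K.faces.Finite)
    (hmax : ∀ f ∈ K.faces, (∀ g ∈ K.faces, f ⊆ g → f = g) → f.card = n + 1)
    (g : Finset (EuclideanSpace ℝ (Fin n))) (hg : g ∈ K.faces)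
    (hsub : ∃ T ∈ K.faces, T.card = n + 1 ∧ g ⊆ T) :
    (∀ x ∈ convexHull ℝ (g : Set (EuclideanSpace ℝ (Fin n))),
        StarConvex ℝ x (macroelement n K g)) ∧
      ContractibleSpace (macroelement n K g) := by
  have hstar : ∀ x ∈ convexHull ℝ (g : Set (EuclideanSpace ℝ (Fin n))),
      StarConvex ℝ x (macroelement n K g) := by
    intro x hx
    unfold macroelement
    refine starConvex_iUnion fun T => starConvex_iUnion fun hT => ?_
    exact (convex_convexHull ℝ _).starConvex
      (convexHull_mono (Finset.coe_subset.2 hT.2.2) hx)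
  refine ⟨hstar, ?_⟩
  obtain ⟨T, hT, hc, hgT⟩ := hsub
  obtain ⟨v, hv⟩ := K.nonempty_of_mem_faces hg
  have hvg : v ∈ convexHull ℝ (g : Set (EuclideanSpace ℝ (Fin n))) :=
    subset_convexHull ℝ _ hv
  refine (hstar v hvg).contractibleSpace ⟨v, ?_⟩
  exact Set.mem_biUnion (show T ∈ {T | T ∈ K.faces ∧ T.card = n + 1 ∧ g ⊆ T} from ⟨hT, hc, hgT⟩)
    (convexHull_mono (Finset.coe_subset.2 hgT) hvg)
end

section
/- Let n, k, r be natural numbers with k ≥ 1, let ℓ : ℝⁿ → ℝ be an affine function whose linear part is nonzero, and let w be a polynomial k-form on ℝⁿ of degree at most r. Define u by u(x) = ℓ(x)·w(x), and suppose u belongs to 𝒫_{r+1}⁻Λ^k. Then w belongs to 𝒫_r⁻Λ^k. -/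
/-- `g : ℝⁿ → ℝ` is a polynomial function of total degree at most `r`. -/
def IsPolyDeg (n r : ℕ) (g : (Fin n → ℝ) → ℝ) : Prop :=
  ∃ p : MvPolynomial (Fin n) ℝ, p.totalDegree ≤ r ∧ ∀ x, g x = MvPolynomial.eval x p

/-- `u` is a polynomial `(k+1)`-form on `ℝⁿ` of degree at most `r`: for every fixed tuple of
vectors, the resulting scalar function is a polynomial of total degree at most `r`. -/
def IsPolyForm (n k r : ℕ)
    (u : (Fin n → ℝ) → AlternatingMap ℝ (Fin n → ℝ) ℝ (Fin (k + 1))) : Prop :=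
  ∀ v : Fin (k + 1) → Fin n → ℝ, IsPolyDeg n r fun x => u x v

/-- `u` belongs to `𝒫_r⁻Λ^{k+1}`: it is a polynomial `(k+1)`-form of degree at most `r` and,
for every `a ∈ ℝⁿ` and all fixed vectors `v_1, …, v_k`, the contracted function
`x ↦ u(x)(x − a, v_1, …, v_k)` is a polynomial of total degree at most `r`. -/
def MemPminusForm (n k r : ℕ)
    (u : (Fin n → ℝ) → AlternatingMap ℝ (Fin n → ℝ) ℝ (Fin (k + 1))) : Prop :=
  IsPolyForm n k r u ∧
    ∀ (a : Fin n → ℝ) (v : Fin k → Fin n → ℝ),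
      IsPolyDeg n r fun x => u x (Fin.cons (x - a) v)

open MvPolynomial in
theorem memPminusForm_of_affine_mul
    (n k r : ℕ) (ℓ : (Fin n → ℝ) →ᵃ[ℝ] ℝ) (hℓ : ℓ.linear ≠ 0)
    (w : (Fin n → ℝ) → AlternatingMap ℝ (Fin n → ℝ) ℝ (Fin (k + 1)))
    (hw : IsPolyForm n k r w)
    (hu : MemPminusForm n k (r + 1) fun x => ℓ x • w x) :
    MemPminusForm n k r w := by
  refine ⟨hw, fun a v => ?_⟩
  -- the contraction is a polynomial
  choose p hpd hp using fun i : Fin n => hw (Fin.cons (Pi.single i 1) v)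
  have hq : ∀ x, w x (Fin.cons (x - a) v)
      = eval x (∑ i, (X i - C (a i)) * p i) := by
    intro x
    have h1 : ∀ y : Fin n → ℝ, w x (Fin.cons y v)
        = ∑ i, y i * w x (Fin.cons (Pi.single i 1) v) := by
      intro y
      have h2 : ∀ z : Fin n → ℝ, w x (Fin.cons z v)
          = ((w x).toMultilinearMap.toLinearMap (Fin.cons 0 v) 0) z := by
        intro z
        simp [MultilinearMap.toLinearMap]
      rw [h2, pi_eq_sum_univ' y, map_sum]
      refine Finset.sum_congr rfl fun i _ => ?_
      rw [map_smul, h2, smul_eq_mul]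
      congr 2
      · simp [Finset.sum_apply, Pi.single_apply]
    rw [h1, map_sum]
    refine Finset.sum_congr rfl fun i _ => ?_
    simp [← hp]
  set q := ∑ i, (X i - C (a i)) * p i
  refine ⟨q, ?_, hq⟩
  -- the affine function is a polynomial
  obtain ⟨L, hL⟩ : ∃ L : MvPolynomial (Fin n) ℝ, ∀ x, ℓ x = eval x L := by
    refine ⟨∑ i, X i * C (ℓ.linear (Pi.single i 1)) + C (ℓ 0), fun x => ?_⟩
    have h3 := congrFun (AffineMap.decomp ℓ) x
    have h4 := LinearMap.pi_apply_eq_sum_univ ℓ.linear x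
    simp only [Pi.add_apply] at h3
    rw [h3, h4]
    simp only [map_add, map_sum, map_mul, eval_X, eval_C, smul_eq_mul]
    congr 1
    refine Finset.sum_congr rfl fun i _ => ?_
    congr 2
    ext j; simp [Pi.single_apply, eq_comm]
  have hL1 : 1 ≤ L.totalDegree := by
    by_contra hc
    have h0 : L.totalDegree = 0 := by omega
    rw [totalDegree_eq_zero_iff_eq_C] at h0
    apply hℓ
    ext1 i
    ext
    have h5 := ℓ.linearMap_vsub (Pi.single i 1) 0
    rw [hL, hL, h0] at h5
    simpa using h5
  obtain ⟨h, hhd, hh⟩ := hu.2 a v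
  have hmul : L * q = h := by
    apply MvPolynomial.funext
    intro x
    rw [← hh x, map_mul, ← hL, ← hq]
    simp
  by_cases hq0 : q = 0
  · simp [hq0]
  have hL0 : L ≠ 0 := by
    rintro rfl
    simp at hL1
  have := totalDegree_mul_of_isDomain hL0 hq0
  rw [hmul] at this
  omega
end
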